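/- For every A ∈ ℂ and every z ∈ ℂ ∖ S, one has the identity (1/2) Φ_e(z;A) Φ_e''(z;A) − (1/4) (Φ_e'(z;A))² − q(z;A) Φ_e(z;A)² = −Y₁(A) Y₂(A); in particular this expression is independent of z (it is the spectral polynomial Q(A)). -/

import Mathlib

open Complex Filter Topology

noncomputable section

/-- The lattice `Λ_τ = ℤ + τℤ`. -/
def Lam (τ : ℂ) : Set ℂ := {ω | ∃ m n : ℤ, ω = (m : ℂ) + (n : ℂ) * τ}

/-- The nonzero lattice points. -/
def Lam' (τ : ℂ) : Set ℂ := {ω | ω ∈ Lam τ ∧ ω ≠ 0}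

/-- The Weierstrass elliptic function `℘(z; τ)`. -/
def wp (τ z : ℂ) : ℂ :=
  1 / z ^ 2 + ∑' ω : Lam' τ, (1 / (z - (ω : ℂ)) ^ 2 - 1 / (ω : ℂ) ^ 2)

/-- The Weierstrass zeta function `ζ(z; τ)`. -/
def wzeta (τ z : ℂ) : ℂ :=
  1 / z + ∑' ω : Lam' τ, (1 / (z - (ω : ℂ)) + 1 / (ω : ℂ) + z / (ω : ℂ) ^ 2)

/-- The Weierstrass sigma function `σ(z; τ)`. -/
def wsigma (τ z : ℂ) : ℂ :=
  z * ∏' ω : Lam' τ,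
    ((1 - z / (ω : ℂ)) * Complex.exp (z / (ω : ℂ) + z ^ 2 / (2 * (ω : ℂ) ^ 2)))

/-- `℘'(z; τ)`. -/
def wpd (τ : ℂ) : ℂ → ℂ := deriv (wp τ)

/-- `℘''(z; τ)`. -/
def wpdd (τ : ℂ) : ℂ → ℂ := deriv (deriv (wp τ))

/-- The constant `B(A)`. -/
def Bc (τ p A : ℂ) : ℂ :=
  A ^ 2 - wzeta τ (2 * p) * A - 3 / 4 * wp τ (2 * p) - 2 * wp τ p

/-- The potential `q(z; A)`. -/
def qpot (τ p A z : ℂ) : ℂ :=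
  2 * wp τ z + 3 / 4 * (wp τ (z + p) + wp τ (z - p))
    + A * (wzeta τ (z + p) - wzeta τ (z - p)) + Bc τ p A

/-- The singular set `S = Λ_τ ∪ (p + Λ_τ) ∪ (−p + Λ_τ)`. -/
def Sset (τ p : ℂ) : Set ℂ :=
  Lam τ ∪ {z | z - p ∈ Lam τ} ∪ {z | z + p ∈ Lam τ}

/-- The unique elliptic solution `Φ_e(z; A)` of the second symmetric product equation. -/
def Phie (τ p A z : ℂ) : ℂ :=
  wp τ z + (A / 2 - 3 * wpdd τ p / (8 * wpd τ p)) * (wzeta τ (z + p) - wzeta τ (z - p))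
    - A ^ 2 + (wpdd τ p / (2 * wpd τ p) - wzeta τ p) * A
    - wp τ p + 3 / 4 * (wpdd τ p / wpd τ p) * wzeta τ p
    + 3 / 16 * (wpdd τ p ^ 2 / wpd τ p ^ 2)

/-- The cubic factor `Y₁(A)`. -/
def Y1 (τ p A : ℂ) : ℂ :=
  A ^ 3 - 5 * wpdd τ p / (4 * wpd τ p) * A ^ 2
    + 3 * (wp τ p + wpdd τ p ^ 2 / (16 * wpd τ p ^ 2)) * A
    + wpd τ p / 2 - 9 * wpdd τ p / (4 * wpd τ p) * wp τ p
    + 9 / 64 * (wpdd τ p ^ 3 / wpd τ p ^ 3)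

/-- The cubic factor `Y₂(A)`. -/
def Y2 (τ p A : ℂ) : ℂ :=
  A ^ 3 - wpdd τ p / (4 * wpd τ p) * A ^ 2
    - 5 / 16 * (wpdd τ p ^ 2 / wpd τ p ^ 2) * A
    + 2 * wpd τ p - 3 / 64 * (wpdd τ p ^ 3 / wpd τ p ^ 3)

namespace PeriodPair

variable (L : PeriodPair)

/-- The Weierstrass zeta function with its pole at the origin removed. -/
def zetaReg (z : ℂ) : ℂ :=
  ∑' l : L.lattice, if (l : ℂ) = 0 then 0 else (1 / (z - l) + 1 / (l : ℂ) + z / (l : ℂ) ^ 2)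

/-- The Weierstrass zeta function attached to a pair of periods. -/
def zeta (z : ℂ) : ℂ := 1 / z + L.zetaReg z

lemma zetaSummand_bound {r : ℝ} {z l : ℂ} (hz : ‖z‖ < r) (hl : 2 * r ≤ ‖l‖) :
    ‖1 / (z - l) + 1 / l + z / l ^ 2‖ ≤ 2 * r ^ 2 * ‖l‖ ^ (-3 : ℝ) := by
  have hr : 0 < r := (norm_nonneg z).trans_lt hz
  have hl0 : 0 < ‖l‖ := by linarith
  have hln : l ≠ 0 := norm_pos_iff.mp hl0
  have hd : ‖l‖ / 2 ≤ ‖z - l‖ := by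
    rw [norm_sub_rev]
    exact le_trans (by linarith) (norm_sub_norm_le l z)
  have hzl : z - l ≠ 0 := norm_pos_iff.mp (by linarith)
  have e : 1 / (z - l) + 1 / l + z / l ^ 2 = z ^ 2 / (l ^ 2 * (z - l)) := by
    field_simp
    ring
  rw [e, norm_div, norm_mul, norm_pow, norm_pow, Real.rpow_neg hl0.le]
  norm_cast
  calc ‖z‖ ^ 2 / (‖l‖ ^ 2 * ‖z - l‖) ≤ r ^ 2 / (‖l‖ ^ 2 * (‖l‖ / 2)) := by gcongr
    _ = 2 * r ^ 2 * (‖l‖ ^ 3)⁻¹ := by field_simp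

lemma hasSumLocallyUniformly_zetaReg :
    HasSumLocallyUniformly (fun (l : L.lattice) (z : ℂ) ↦
      if (l : ℂ) = 0 then 0 else (1 / (z - l) + 1 / (l : ℂ) + z / (l : ℂ) ^ 2)) L.zetaReg := by
  refine L.hasSumLocallyUniformly_aux (u := fun r l ↦ 2 * r ^ 2 * ‖(l : ℂ)‖ ^ (-3 : ℝ)) _
    (fun _ _ ↦ (ZLattice.summable_norm_rpow _ _ (by simp; norm_num)).mul_left _) fun r hr ↦
    Filter.eventually_atTop.mpr ⟨2 * r, ?_⟩
  rintro _ h s hs l rfl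
  split_ifs
  · simp only [norm_zero]
    positivity
  · exact zetaSummand_bound hs h

lemma hasDerivAt_zetaSummand {z l : ℂ} (h : z ≠ l) :
    HasDerivAt (fun z ↦ 1 / (z - l) + 1 / l + z / l ^ 2) (-(1 / (z - l) ^ 2 - 1 / l ^ 2)) z := by
  have h' : z - l ≠ 0 := sub_ne_zero.mpr h
  have h1 : HasDerivAt (fun z ↦ 1 / (z - l)) (-1 / (z - l) ^ 2) z := by
    simpa [one_div] using ((hasDerivAt_id z).sub_const l).fun_inv h'
  exact ((h1.add_const (1 / l)).add ((hasDerivAt_id z).div_const (l ^ 2))).congr_deriv (by ring)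

lemma hasDerivAt_ite_zetaSummand {z : ℂ} (hz : z ∈ ((L.lattice : Set ℂ) \ {0})ᶜ) (l : L.lattice) :
    HasDerivAt (fun z ↦ if (l : ℂ) = 0 then 0 else (1 / (z - l) + 1 / (l : ℂ) + z / (l : ℂ) ^ 2))
      (-(if (l : ℂ) = 0 then 0 else (1 / (z - l) ^ 2 - 1 / (l : ℂ) ^ 2))) z := by
  split_ifs with h
  · simpa using hasDerivAt_const z (0 : ℂ)
  · refine hasDerivAt_zetaSummand ?_
    rintro rfl
    exact hz ⟨l.2, h⟩

lemma hasDerivAt_zetaReg {z : ℂ} (hz : z ∈ ((L.lattice : Set ℂ) \ {0})ᶜ) :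
    HasDerivAt L.zetaReg (-L.weierstrassPExcept 0 z) z := by
  have hU : IsOpen ((L.lattice : Set ℂ) \ {0})ᶜ := L.isOpen_compl_lattice_sdiff
  have hd : DifferentiableOn ℂ L.zetaReg ((L.lattice : Set ℂ) \ {0})ᶜ :=
    L.hasSumLocallyUniformly_zetaReg.hasSumLocallyUniformlyOn.differentiableOn
      (.of_forall fun s ↦ .fun_sum fun i hi w hw ↦
        (L.hasDerivAt_ite_zetaSummand hw i).differentiableAt.differentiableWithinAt) hU
  have h1 := L.hasSumLocallyUniformly_zetaReg.tendstoLocallyUniformlyOn.deriv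
    (.of_forall fun s ↦ .fun_sum fun i hi w hw ↦
        (L.hasDerivAt_ite_zetaSummand hw i).differentiableAt.differentiableWithinAt) hU
  have e : deriv L.zetaReg z = -L.weierstrassPExcept 0 z := by
    refine tendsto_nhds_unique (h1.tendsto_at hz) ?_
    refine (L.hasSum_weierstrassPExcept 0 z).neg.congr fun s ↦ ?_
    exact Eq.symm <| (HasDerivAt.fun_sum fun i _ ↦ L.hasDerivAt_ite_zetaSummand hz i).deriv
  rw [← e]
  exact (hd.differentiableAt (hU.mem_nhds hz)).hasDerivAt

lemma hasDerivAt_zeta {z : ℂ} (hz : z ∉ L.lattice) :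
    HasDerivAt L.zeta (-L.weierstrassP z) z := by
  have h0 : z ≠ 0 := by
    rintro rfl
    exact hz L.lattice.zero_mem
  have h1 : HasDerivAt (fun z : ℂ ↦ 1 / z) (-(z ^ 2)⁻¹) z := by
    simpa [one_div] using hasDerivAt_inv h0
  refine (h1.add (L.hasDerivAt_zetaReg (z := z) (fun h ↦ hz h.1))).congr_deriv ?_
  rw [← L.weierstrassPExcept_add 0]
  simp

lemma zetaReg_neg (z : ℂ) : L.zetaReg (-z) = -L.zetaReg z := by
  simp only [zetaReg]
  rw [← (Equiv.neg L.lattice).tsum_eq, ← tsum_neg]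
  congr with l
  simp only [Equiv.neg_apply, NegMemClass.coe_neg, neg_eq_zero]
  split_ifs
  · simp
  · rw [show -z - -(l : ℂ) = -(z - l) by ring, div_neg, div_neg]
    ring

lemma zeta_neg (z : ℂ) : L.zeta (-z) = -L.zeta z := by
  simp only [zeta, zetaReg_neg, div_neg]
  ring

lemma isPreconnected_compl_lattice : IsPreconnected ((L.lattice : Set ℂ)ᶜ) :=
  (Set.Countable.isConnected_compl_of_one_lt_rank (by simp)
    (countable_of_Lindelof_of_discrete (X := L.lattice))).2

lemma zeta_add_coe_sub {z w : ℂ} (hz : z ∉ L.lattice) (hw : w ∉ L.lattice) (l : L.lattice) :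
    L.zeta (z + l) - L.zeta (w + l) = L.zeta z - L.zeta w := by
  have hd : ∀ x : ℂ, x ∉ L.lattice → HasDerivAt (fun x ↦ L.zeta (x + l) - L.zeta x) 0 x := by
    intro x hx
    have hx' : x + l ∉ L.lattice := fun h ↦ hx (by simpa using sub_mem h l.2)
    exact (((L.hasDerivAt_zeta hx').comp_add_const x (l : ℂ)).sub
      (L.hasDerivAt_zeta hx)).congr_deriv (by simp)
  have := L.isClosed_lattice.isOpen_compl.is_const_of_deriv_eq_zero L.isPreconnected_compl_lattice
    (f := fun x ↦ L.zeta (x + l) - L.zeta x)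
    (fun x hx ↦ (hd x hx).differentiableAt.differentiableWithinAt)
    (fun x hx ↦ (hd x hx).deriv) hz hw
  linear_combination this

lemma notMem_of_two_mul_notMem {p : ℂ} (hp : 2 * p ∉ L.lattice) : p ∉ L.lattice := fun h ↦
  hp (by simpa [two_mul] using add_mem h h)

lemma hasDerivAt_weierstrassP {z : ℂ} (hz : z ∉ L.lattice) :
    HasDerivAt L.weierstrassP (L.derivWeierstrassP z) z := by
  rw [← L.deriv_weierstrassP]
  exact (L.analyticOnNhd_weierstrassP z hz).differentiableAt.hasDerivAt

lemma eventually_notMem_lattice {z : ℂ} (hz : z ∉ L.lattice) : ∀ᶠ w in 𝓝 z, w ∉ L.lattice :=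
  L.isClosed_lattice.isOpen_compl.mem_nhds hz

lemma eventually_add_notMem_lattice {z c : ℂ} (hz : z + c ∉ L.lattice) :
    ∀ᶠ w in 𝓝 z, w + c ∉ L.lattice :=
  (continuous_id.add continuous_const).continuousAt.eventually (L.eventually_notMem_lattice hz)

lemma eventually_sub_notMem_lattice {z c : ℂ} (hz : z - c ∉ L.lattice) :
    ∀ᶠ w in 𝓝 z, w - c ∉ L.lattice :=
  (continuous_id.sub continuous_const).continuousAt.eventually (L.eventually_notMem_lattice hz)

lemma eventually_nhdsNE_notMem_lattice (z : ℂ) : ∀ᶠ w in 𝓝[≠] z, w ∉ L.lattice := by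
  filter_upwards [self_mem_nhdsWithin,
    mem_nhdsWithin_of_mem_nhds (L.compl_lattice_sdiff_singleton_mem_nhds z)] with w hw hw' h
  exact hw' ⟨h, hw⟩

lemma eventually_nhdsNE_add_notMem_lattice (c z : ℂ) : ∀ᶠ w in 𝓝[≠] z, w + c ∉ L.lattice := by
  filter_upwards [self_mem_nhdsWithin, (continuous_id.add continuous_const).continuousAt.eventually
    (L.compl_lattice_sdiff_singleton_mem_nhds (z + c)) |>.filter_mono nhdsWithin_le_nhds]
    with w hw hw' h
  exact hw' ⟨h, fun e ↦ hw (by simpa using e)⟩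

lemma eventually_nhdsNE_sub_notMem_lattice (p : ℂ) : ∀ᶠ z in 𝓝[≠] p, z - p ∉ L.lattice := by
  simpa [sub_eq_add_neg] using L.eventually_nhdsNE_add_notMem_lattice (-p) p

lemma analyticAt_zeta {z : ℂ} (hz : z ∉ L.lattice) : AnalyticAt ℂ L.zeta z :=
  DifferentiableOn.analyticAt (s := (L.lattice : Set ℂ)ᶜ)
    (fun _ hw ↦ (L.hasDerivAt_zeta hw).differentiableAt.differentiableWithinAt)
    (L.isClosed_lattice.isOpen_compl.mem_nhds hz)

/-- The even function `ζ(z + p) - ζ(z - p) - 2 ζ(p)`, which vanishes to second order at `0`. -/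
def zetaDiff (p z : ℂ) : ℂ := L.zeta (z + p) - L.zeta (z - p) - 2 * L.zeta p

lemma hasDerivAt_zetaDiff {p z : ℂ} (h₁ : z + p ∉ L.lattice) (h₂ : z - p ∉ L.lattice) :
    HasDerivAt (L.zetaDiff p) (-L.weierstrassP (z + p) + L.weierstrassP (z - p)) z :=
  ((((L.hasDerivAt_zeta h₁).comp_add_const z p).sub
    ((L.hasDerivAt_zeta h₂).comp_sub_const z p)).sub_const _).congr_deriv (by ring)

lemma analyticAt_zetaDiff {p z : ℂ} (h₁ : z + p ∉ L.lattice) (h₂ : z - p ∉ L.lattice) :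
    AnalyticAt ℂ (L.zetaDiff p) z := by
  have a₁ : AnalyticAt ℂ (fun z ↦ L.zeta (z + p)) z :=
    (L.analyticAt_zeta h₁).comp_of_eq (by fun_prop) rfl
  have a₂ : AnalyticAt ℂ (fun z ↦ L.zeta (z - p)) z :=
    (L.analyticAt_zeta h₂).comp_of_eq (by fun_prop) rfl
  exact (a₁.sub a₂).sub analyticAt_const

lemma zetaDiff_neg (p z : ℂ) : L.zetaDiff p (-z) = L.zetaDiff p z := by
  rw [zetaDiff, zetaDiff, show -z + p = -(z - p) by ring, show -z - p = -(z + p) by ring,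
    zeta_neg, zeta_neg]
  ring

lemma zetaDiff_add_coe {p z : ℂ} (h₁ : z + p ∉ L.lattice) (h₂ : z - p ∉ L.lattice)
    (l : L.lattice) : L.zetaDiff p (z + l) = L.zetaDiff p z := by
  rw [zetaDiff, zetaDiff, add_right_comm z _ p, add_sub_right_comm z _ p,
    L.zeta_add_coe_sub h₁ h₂ l]

/-- An analytic function vanishing to second order at `0` is asymptotic to its quadratic term. -/
lemma _root_.AnalyticAt.tendsto_div_sq {f : ℂ → ℂ} (hf : AnalyticAt ℂ f 0) (h₀ : f 0 = 0)
    (h₁ : deriv f 0 = 0) :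
    Tendsto (fun z ↦ f z / z ^ 2) (𝓝[≠] 0) (𝓝 (deriv (deriv f) 0 / 2)) := by
  have h2 : ((2 : ℕ) : ℕ∞) ≤ analyticOrderAt f 0 := by
    rw [natCast_le_analyticOrderAt_iff_iteratedDeriv_eq_zero hf]
    intro i hi
    interval_cases i
    · simpa using h₀
    · simpa using h₁
  obtain ⟨g, hg, hfg⟩ := (natCast_le_analyticOrderAt hf).mp h2
  simp only [sub_zero, smul_eq_mul] at hfg
  have hd : deriv f =ᶠ[𝓝 0] fun z ↦ 2 * z * g z + z ^ 2 * deriv g z := by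
    filter_upwards [hfg.eventually_nhds, hg.eventually_analyticAt] with z hz hgz
    rw [EventuallyEq.deriv_eq hz]
    exact (((hasDerivAt_pow 2 z).mul hgz.differentiableAt.hasDerivAt)).deriv.trans (by simp)
  have hdd : deriv (deriv f) 0 = 2 * g 0 := by
    rw [hd.deriv_eq]
    have e₁ : HasDerivAt (fun z : ℂ ↦ 2 * z) 2 0 := by
      simpa using (hasDerivAt_id (0 : ℂ)).const_mul 2
    exact ((e₁.mul hg.differentiableAt.hasDerivAt).add ((hasDerivAt_pow 2 0).mul
      hg.deriv.differentiableAt.hasDerivAt)).deriv.trans (by simp)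
  rw [hdd, mul_div_cancel_left₀ _ two_ne_zero]
  refine (hg.continuousAt.tendsto.mono_left nhdsWithin_le_nhds).congr' ?_
  filter_upwards [self_mem_nhdsWithin, hfg.filter_mono nhdsWithin_le_nhds] with z hz hfz
  rw [hfz, mul_div_cancel_left₀ _ (pow_ne_zero 2 hz)]

lemma tendsto_zetaDiff_div_sq {p : ℂ} (hp : p ∉ L.lattice) :
    Tendsto (fun z ↦ L.zetaDiff p z / z ^ 2) (𝓝[≠] 0) (𝓝 (-L.derivWeierstrassP p)) := by
  have hd : deriv (L.zetaDiff p) =ᶠ[𝓝 0]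
      fun z ↦ -L.weierstrassP (z + p) + L.weierstrassP (z - p) := by
    filter_upwards [L.eventually_add_notMem_lattice (z := 0) (c := p) (by simpa),
      L.eventually_sub_notMem_lattice (z := 0) (c := p) (by simpa)] with z h₁ h₂
    exact (L.hasDerivAt_zetaDiff h₁ h₂).deriv
  have hdd : deriv (deriv (L.zetaDiff p)) 0 / 2 = -L.derivWeierstrassP p := by
    rw [hd.deriv_eq]
    have h₁ := (L.hasDerivAt_weierstrassP (z := 0 + p) (by simpa)).comp_add_const 0 p
    have h₂ := (L.hasDerivAt_weierstrassP (z := 0 - p) (by simpa)).comp_sub_const 0 p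
    rw [(h₁.fun_neg.fun_add h₂).deriv]
    simp
  rw [← hdd]
  refine (L.analyticAt_zetaDiff (by simpa) (by simpa)).tendsto_div_sq ?_ ?_
  · simp only [zetaDiff, zero_add, zero_sub, zeta_neg]
    ring
  · rw [hd.self_of_nhds]
    simp

open Classical in
/-- The entire elliptic function `(ζ(z + p) - ζ(z - p) - 2 ζ(p)) (℘(z) - ℘(p)) + ℘'(p)`,
with value `0` filled in at its removable singularities. -/
def zetaRelation (p z : ℂ) : ℂ :=
  if z ∈ L.lattice ∨ z + p ∈ L.lattice ∨ z - p ∈ L.lattice then 0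
  else L.zetaDiff p z * (L.weierstrassP z - L.weierstrassP p) + L.derivWeierstrassP p

lemma zetaRelation_of_notMem {p z : ℂ} (h₀ : z ∉ L.lattice) (h₁ : z + p ∉ L.lattice)
    (h₂ : z - p ∉ L.lattice) : L.zetaRelation p z =
      L.zetaDiff p z * (L.weierstrassP z - L.weierstrassP p) + L.derivWeierstrassP p := by
  simp [zetaRelation, h₀, h₁, h₂]

lemma zetaRelation_add_coe (p z : ℂ) (l : L.lattice) :
    L.zetaRelation p (z + l) = L.zetaRelation p z := by
  have h (w : ℂ) : w + l ∈ L.lattice ↔ w ∈ L.lattice :=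
    L.lattice.toAddSubgroup.add_mem_cancel_right l.2
  by_cases hz : z ∈ L.lattice ∨ z + p ∈ L.lattice ∨ z - p ∈ L.lattice
  · rw [zetaRelation, zetaRelation, if_pos hz, if_pos]
    simpa only [add_right_comm z _ p, add_sub_right_comm z _ p, h] using hz
  · have hz' := hz
    push Not at hz'
    rw [zetaRelation, zetaRelation, if_neg hz, if_neg, weierstrassP_add_coe,
      L.zetaDiff_add_coe hz'.2.1 hz'.2.2]
    simpa only [add_right_comm z _ p, add_sub_right_comm z _ p, h] using hz

lemma zetaRelation_neg (p z : ℂ) : L.zetaRelation p (-z) = L.zetaRelation p z := by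
  have h₁ : -z + p ∈ L.lattice ↔ z - p ∈ L.lattice := by
    rw [← neg_mem_iff]
    simp [sub_eq_add_neg, add_comm]
  have h₂ : -z - p ∈ L.lattice ↔ z + p ∈ L.lattice := by
    rw [← neg_mem_iff]
    simp [add_comm]
  rw [zetaRelation, zetaRelation, zetaDiff_neg, weierstrassP_neg]
  classical
  exact if_congr (by rw [neg_mem_iff, h₁, h₂, or_comm (a := z - p ∈ L.lattice)]) rfl rfl

lemma continuousAt_zetaRelation_zero {p : ℂ} (hp : p ∉ L.lattice) :
    ContinuousAt (L.zetaRelation p) 0 := by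
  have e0 : L.zetaRelation p 0 = 0 := by simp [zetaRelation]
  have hc : ContinuousAt (L.zetaDiff p) 0 :=
    (L.analyticAt_zetaDiff (by simpa) (by simpa)).continuousAt
  have hz0 : L.zetaDiff p 0 = 0 := by
    simp only [zetaDiff, zero_add, zero_sub, zeta_neg]
    ring
  have hP : ContinuousAt (L.weierstrassPExcept 0) 0 :=
    (L.analyticAt_weierstrassPExcept 0).continuousAt
  have ht : Tendsto (fun z ↦ L.zetaDiff p z / z ^ 2 +
      L.zetaDiff p z * (L.weierstrassPExcept 0 z - L.weierstrassP p) + L.derivWeierstrassP p)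
      (𝓝[≠] 0) (𝓝 0) := by
    have := ((L.tendsto_zetaDiff_div_sq hp).add ((hc.mul (hP.sub (continuousAt_const
      (y := L.weierstrassP p)))).tendsto.mono_left nhdsWithin_le_nhds)).add_const
      (L.derivWeierstrassP p)
    simpa [hz0] using this
  rw [continuousAt_iff_punctured_nhds, e0]
  refine ht.congr' ?_
  filter_upwards [self_mem_nhdsWithin, L.eventually_nhdsNE_notMem_lattice 0,
    (L.eventually_add_notMem_lattice (z := 0) (c := p) (by simpa)).filter_mono nhdsWithin_le_nhds,
    (L.eventually_sub_notMem_lattice (z := 0) (c := p) (by simpa)).filter_mono nhdsWithin_le_nhds]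
    with z hz h₀ h₁ h₂
  rw [L.zetaRelation_of_notMem h₀ h₁ h₂, ← L.weierstrassPExcept_add 0 z]
  simp
  ring

lemma continuousAt_zetaRelation_self {p : ℂ} (hp : 2 * p ∉ L.lattice) :
    ContinuousAt (L.zetaRelation p) p := by
  have hp₀ := L.notMem_of_two_mul_notMem hp
  have hpp : p + p ∉ L.lattice := by rwa [← two_mul]
  have e0 : L.zetaRelation p p = 0 := by simp [zetaRelation]
  have hd := L.hasDerivAt_weierstrassP hp₀
  have hz : ContinuousAt (fun z ↦ L.zeta (z + p) - L.zetaReg (z - p) - 2 * L.zeta p) p := by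
    have h₁ : ContinuousAt (fun z ↦ L.zeta (z + p)) p :=
      ((L.hasDerivAt_zeta hpp).comp_add_const p p).continuousAt
    have h₂ : ContinuousAt (fun z ↦ L.zetaReg (z - p)) p :=
      ((L.hasDerivAt_zetaReg (z := p - p) (by simp)).comp_sub_const p p).continuousAt
    exact (h₁.sub h₂).sub continuousAt_const
  have ht : Tendsto (fun z ↦ (L.zeta (z + p) - L.zetaReg (z - p) - 2 * L.zeta p) *
      (L.weierstrassP z - L.weierstrassP p) - slope L.weierstrassP p z + L.derivWeierstrassP p)
      (𝓝[≠] p) (𝓝 0) := by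
    have := (((hz.mul (hd.continuousAt.sub (continuousAt_const
      (y := L.weierstrassP p)))).tendsto.mono_left nhdsWithin_le_nhds).sub
      (hasDerivAt_iff_tendsto_slope.mp hd)).add_const (L.derivWeierstrassP p)
    simpa using this
  rw [continuousAt_iff_punctured_nhds, e0]
  refine ht.congr' ?_
  filter_upwards [L.eventually_nhdsNE_sub_notMem_lattice p,
    (L.eventually_notMem_lattice hp₀).filter_mono nhdsWithin_le_nhds,
    (L.eventually_add_notMem_lattice hpp).filter_mono nhdsWithin_le_nhds] with z h₂ h₀ h₁
  rw [L.zetaRelation_of_notMem h₀ h₁ h₂, slope_def_field, zetaDiff,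
    show L.zeta (z - p) = 1 / (z - p) + L.zetaReg (z - p) from rfl]
  ring

lemma continuousAt_zetaRelation_add_coe {p z : ℂ} (h : ContinuousAt (L.zetaRelation p) z)
    (l : L.lattice) : ContinuousAt (L.zetaRelation p) (z + l) := by
  have e : L.zetaRelation p = L.zetaRelation p ∘ fun w ↦ w - (l : ℂ) := by
    ext w
    simpa using L.zetaRelation_add_coe p (w - l) l
  rw [e]
  exact ContinuousAt.comp (by simpa using h) (by fun_prop)

lemma differentiableAt_zetaRelation {p z : ℂ} (h₀ : z ∉ L.lattice) (h₁ : z + p ∉ L.lattice)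
    (h₂ : z - p ∉ L.lattice) : DifferentiableAt ℂ (L.zetaRelation p) z := by
  refine (((L.hasDerivAt_zetaDiff h₁ h₂).mul ((L.hasDerivAt_weierstrassP h₀).sub_const
    (L.weierstrassP p))).add_const (L.derivWeierstrassP p)).differentiableAt.congr_of_eventuallyEq ?_
  filter_upwards [L.eventually_notMem_lattice h₀, L.eventually_add_notMem_lattice h₁,
    L.eventually_sub_notMem_lattice h₂] with w w₀ w₁ w₂
  exact L.zetaRelation_of_notMem w₀ w₁ w₂

lemma continuous_zetaRelation {p : ℂ} (hp : 2 * p ∉ L.lattice) :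
    Continuous (L.zetaRelation p) := by
  refine continuous_iff_continuousAt.mpr fun z ↦ ?_
  by_cases h₀ : z ∈ L.lattice
  · simpa using L.continuousAt_zetaRelation_add_coe (L.continuousAt_zetaRelation_zero
      (L.notMem_of_two_mul_notMem hp)) ⟨z, h₀⟩
  have hself := L.continuousAt_zetaRelation_self hp
  by_cases h₂ : z - p ∈ L.lattice
  · simpa using L.continuousAt_zetaRelation_add_coe hself ⟨z - p, h₂⟩
  by_cases h₁ : z + p ∈ L.lattice
  · have hneg : ContinuousAt (L.zetaRelation p) (-p) := by
      have e : L.zetaRelation p = L.zetaRelation p ∘ fun w ↦ -w := by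
        ext w
        simp [zetaRelation_neg]
      rw [e]
      exact ContinuousAt.comp (by simpa using hself) (by fun_prop)
    simpa using L.continuousAt_zetaRelation_add_coe hneg ⟨z + p, h₁⟩
  exact (L.differentiableAt_zetaRelation h₀ h₁ h₂).continuousAt

lemma zetaRelation_eq_zero {p : ℂ} (hp : 2 * p ∉ L.lattice) (z : ℂ) : L.zetaRelation p z = 0 := by
  have hc := L.continuous_zetaRelation hp
  have hd : Differentiable ℂ (L.zetaRelation p) := fun x ↦ by
    refine (Complex.analyticAt_of_differentiable_on_punctured_nhds_of_continuousAt ?_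
      hc.continuousAt).differentiableAt
    have h (c : ℂ) := L.eventually_nhdsNE_add_notMem_lattice c x
    filter_upwards [h 0, h p, h (-p)] with w h₀ h₁ h₂
    exact L.differentiableAt_zetaRelation (by simpa using h₀) h₁ (by simpa [sub_eq_add_neg] using h₂)
  refine (hd.apply_eq_apply_of_bounded (IsZLattice.isCompact_range_of_periodic L.lattice _ hc
    fun z w hw ↦ ?_).isBounded z 0).trans (by simp [zetaRelation])
  lift w to L.lattice using hw
  exact L.zetaRelation_add_coe p z w

lemma zetaDiff_mul {p z : ℂ} (hp : 2 * p ∉ L.lattice) (h₀ : z ∉ L.lattice)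
    (h₁ : z + p ∉ L.lattice) (h₂ : z - p ∉ L.lattice) :
    L.zetaDiff p z * (L.weierstrassP z - L.weierstrassP p) = -L.derivWeierstrassP p := by
  rw [← add_eq_zero_iff_eq_neg, ← L.zetaRelation_of_notMem h₀ h₁ h₂, L.zetaRelation_eq_zero hp]

lemma not_forall_weierstrassP_eq (c : ℂ) : ¬ ∀ z ∉ L.lattice, L.weierstrassP z = c := by
  intro h
  have hP : ContinuousAt (fun z ↦ z ^ 2 * (L.weierstrassPExcept 0 z - c) + 1) 0 :=
    (((continuous_pow 2).continuousAt).mul ((L.analyticAt_weierstrassPExcept 0).continuousAt.sub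
      continuousAt_const)).add continuousAt_const
  have ht : Tendsto (fun z ↦ z ^ 2 * (L.weierstrassPExcept 0 z - c) + 1) (𝓝[≠] 0) (𝓝 1) := by
    simpa using hP.tendsto.mono_left (nhdsWithin_le_nhds (s := {0}ᶜ))
  refine zero_ne_one (tendsto_nhds_unique (tendsto_const_nhds.congr' ?_) ht)
  filter_upwards [self_mem_nhdsWithin, L.eventually_nhdsNE_notMem_lattice 0] with z hz h₀
  have hz : z ≠ 0 := hz
  rw [← h z h₀, ← L.weierstrassPExcept_add 0 z]
  simp
  field_simp
  ring

lemma derivWeierstrassP_ne_zero {p : ℂ} (hp : 2 * p ∉ L.lattice) :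
    L.derivWeierstrassP p ≠ 0 := by
  intro hb
  have hp₀ := L.notMem_of_two_mul_notMem hp
  have hpp : p + p ∉ L.lattice := by rwa [← two_mul]
  have han : AnalyticOnNhd ℂ (fun z ↦ L.weierstrassP z - L.weierstrassP p) (L.lattice : Set ℂ)ᶜ :=
    L.analyticOnNhd_weierstrassP.sub analyticOnNhd_const
  rcases (han p hp₀).eventually_eq_zero_or_eventually_ne_zero with h | h
  · refine L.not_forall_weierstrassP_eq (L.weierstrassP p) fun z hz ↦ ?_
    exact sub_eq_zero.mp
      (han.eqOn_zero_of_preconnected_of_eventuallyEq_zero L.isPreconnected_compl_lattice hp₀ h hz)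
  · have hc : ContinuousAt
        (fun z ↦ (z - p) * (L.zeta (z + p) - L.zetaReg (z - p) - 2 * L.zeta p) - 1) p := by
      have h₁ : ContinuousAt (fun z ↦ L.zeta (z + p)) p :=
        ((L.hasDerivAt_zeta hpp).comp_add_const p p).continuousAt
      have h₂ : ContinuousAt (fun z ↦ L.zetaReg (z - p)) p :=
        ((L.hasDerivAt_zetaReg (z := p - p) (by simp)).comp_sub_const p p).continuousAt
      fun_prop
    have ht : Tendsto (fun z ↦ (z - p) * (L.zeta (z + p) - L.zetaReg (z - p) - 2 * L.zeta p) - 1)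
        (𝓝[≠] p) (𝓝 (-1)) := by
      simpa using hc.tendsto.mono_left (nhdsWithin_le_nhds (s := {p}ᶜ))
    refine neg_ne_zero.mpr one_ne_zero
      (tendsto_nhds_unique ht ((tendsto_const_nhds (x := (0 : ℂ))).congr' ?_))
    filter_upwards [self_mem_nhdsWithin, h, L.eventually_nhdsNE_sub_notMem_lattice p,
      (L.eventually_notMem_lattice hp₀).filter_mono nhdsWithin_le_nhds,
      (L.eventually_add_notMem_lattice hpp).filter_mono nhdsWithin_le_nhds] with z hz hne h₂ h₀ h₁
    have hzp : z - p ≠ 0 := sub_ne_zero.mpr hz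
    have hmul := L.zetaDiff_mul hp h₀ h₁ h₂
    rw [hb, neg_zero, mul_eq_zero, or_iff_left hne, zetaDiff,
      show L.zeta (z - p) = 1 / (z - p) + L.zetaReg (z - p) from rfl] at hmul
    have : (z - p) * (1 / (z - p)) = 1 := mul_one_div_cancel hzp
    linear_combination -(z - p) * hmul - this

lemma weierstrassP_sub_ne_zero {p z : ℂ} (hp : 2 * p ∉ L.lattice) (h₀ : z ∉ L.lattice)
    (h₁ : z + p ∉ L.lattice) (h₂ : z - p ∉ L.lattice) :
    L.weierstrassP z - L.weierstrassP p ≠ 0 := by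
  intro h
  have := L.zetaDiff_mul hp h₀ h₁ h₂
  rw [h, mul_zero, eq_comm, neg_eq_zero] at this
  exact L.derivWeierstrassP_ne_zero hp this

lemma zetaDiff_eq {p z : ℂ} (hp : 2 * p ∉ L.lattice) (h₀ : z ∉ L.lattice)
    (h₁ : z + p ∉ L.lattice) (h₂ : z - p ∉ L.lattice) :
    L.zetaDiff p z = -L.derivWeierstrassP p / (L.weierstrassP z - L.weierstrassP p) :=
  (eq_div_iff (L.weierstrassP_sub_ne_zero hp h₀ h₁ h₂)).mpr (L.zetaDiff_mul hp h₀ h₁ h₂)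

lemma hasDerivAt_derivWeierstrassP {z : ℂ} (hz : z ∉ L.lattice) :
    HasDerivAt L.derivWeierstrassP (6 * L.weierstrassP z ^ 2 - L.g₂ / 2) z := by
  have hP := L.analyticOnNhd_weierstrassP
  have hP' := L.analyticOnNhd_derivWeierstrassP
  have key : ∀ w ∈ (L.lattice : Set ℂ)ᶜ, L.derivWeierstrassP w *
      (deriv L.derivWeierstrassP w - (6 * L.weierstrassP w ^ 2 - L.g₂ / 2)) = 0 := by
    intro w hw
    have d₁ := (hP' w hw).differentiableAt.hasDerivAt.pow 2
    have dP := L.hasDerivAt_weierstrassP hw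
    have d₂ := (((dP.pow 3).const_mul 4).sub (dP.const_mul L.g₂)).sub_const L.g₃
    have e := d₁.unique (d₂.congr_of_eventuallyEq <| by
      filter_upwards [L.eventually_notMem_lattice hw] with x hx using L.derivWeierstrassP_sq x hx)
    norm_num at e
    linear_combination e / 2
  rcases AnalyticOnNhd.eq_zero_or_eq_zero_of_mul_eq_zero hP' (hP'.deriv.sub
      ((analyticOnNhd_const.mul (hP.pow 2)).sub analyticOnNhd_const)) key
      L.isPreconnected_compl_lattice with h | h
  · refine absurd (h (L.ω₁ / 4) ?_) (L.derivWeierstrassP_ne_zero ?_)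
    · refine L.notMem_of_two_mul_notMem ?_
      rw [show 2 * (L.ω₁ / 4) = L.ω₁ / 2 by ring]
      exact L.ω₁_div_two_notMem_lattice
    · rw [show 2 * (L.ω₁ / 4) = L.ω₁ / 2 by ring]
      exact L.ω₁_div_two_notMem_lattice
  · have e : deriv L.derivWeierstrassP z = 6 * L.weierstrassP z ^ 2 - L.g₂ / 2 :=
      sub_eq_zero.mp (h z hz)
    rw [← e]
    exact (hP' z hz).differentiableAt.hasDerivAt

lemma eventually_two_mul_notMem_lattice {p : ℂ} (hp : 2 * p ∉ L.lattice) :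
    ∀ᶠ w in 𝓝 p, 2 * w ∉ L.lattice :=
  (continuous_const.mul continuous_id).continuousAt.eventually (L.eventually_notMem_lattice hp)

lemma weierstrassP_add_add_weierstrassP_sub {p z : ℂ} (hp : 2 * p ∉ L.lattice)
    (h₀ : z ∉ L.lattice) (h₁ : z + p ∉ L.lattice) (h₂ : z - p ∉ L.lattice) :
    L.weierstrassP (z + p) + L.weierstrassP (z - p) = 2 * L.weierstrassP p +
      deriv L.derivWeierstrassP p / (L.weierstrassP z - L.weierstrassP p) +
      L.derivWeierstrassP p ^ 2 / (L.weierstrassP z - L.weierstrassP p) ^ 2 := by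
  have hp₀ := L.notMem_of_two_mul_notMem hp
  have hu := L.weierstrassP_sub_ne_zero hp h₀ h₁ h₂
  have d₁ : HasDerivAt (fun q ↦ L.zetaDiff q z)
      (-L.weierstrassP (z + p) - L.weierstrassP (z - p) + 2 * L.weierstrassP p) p :=
    ((((L.hasDerivAt_zeta h₁).comp_const_add z p).sub
      ((L.hasDerivAt_zeta h₂).comp_const_sub z p)).sub
      ((L.hasDerivAt_zeta hp₀).const_mul 2)).congr_deriv (by ring)
  have d₂ := ((L.analyticOnNhd_derivWeierstrassP p hp₀).differentiableAt.hasDerivAt.fun_neg).fun_div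
    ((L.hasDerivAt_weierstrassP hp₀).const_sub (L.weierstrassP z)) hu
  have hop : ∀ᶠ q in 𝓝 p, z - q ∉ L.lattice :=
    (continuous_const.sub continuous_id).continuousAt.eventually (L.eventually_notMem_lattice h₂)
  have hop' : ∀ᶠ q in 𝓝 p, z + q ∉ L.lattice :=
    (continuous_const.add continuous_id).continuousAt.eventually (L.eventually_notMem_lattice h₁)
  have e := d₁.unique (d₂.congr_of_eventuallyEq <| by
    filter_upwards [L.eventually_two_mul_notMem_lattice hp, hop, hop'] with q hq hq₂ hq₁
    exact L.zetaDiff_eq hq h₀ hq₁ hq₂)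
  field_simp at e ⊢
  linear_combination -e

lemma zeta_two_mul {p : ℂ} (hp : 2 * p ∉ L.lattice) :
    2 * (L.zeta (2 * p) - 2 * L.zeta p) * L.derivWeierstrassP p = deriv L.derivWeierstrassP p := by
  have hp₀ := L.notMem_of_two_mul_notMem hp
  have hpp : p + p ∉ L.lattice := by rwa [← two_mul]
  have hc : ContinuousAt (fun z ↦ 2 * (L.zeta (z + p) - L.zeta z - L.zeta p)) p := by
    have h₁ : ContinuousAt (fun z ↦ L.zeta (z + p)) p :=
      ((L.hasDerivAt_zeta hpp).comp_add_const p p).continuousAt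
    have h₂ := (L.hasDerivAt_zeta hp₀).continuousAt
    fun_prop
  have ht := (hc.tendsto.mono_left nhdsWithin_le_nhds).mul
    (hasDerivAt_iff_tendsto_slope.mp (L.hasDerivAt_weierstrassP hp₀))
  have ht' := hasDerivAt_iff_tendsto_slope.mp
    (L.analyticOnNhd_derivWeierstrassP p hp₀).differentiableAt.hasDerivAt
  rw [two_mul p, two_mul (L.zeta p), ← sub_sub]
  refine tendsto_nhds_unique ht (ht'.congr' ?_)
  filter_upwards [self_mem_nhdsWithin, L.eventually_nhdsNE_sub_notMem_lattice p,
    (L.eventually_notMem_lattice hp₀).filter_mono nhdsWithin_le_nhds,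
    (L.eventually_two_mul_notMem_lattice hp).filter_mono nhdsWithin_le_nhds,
    (L.eventually_add_notMem_lattice hpp).filter_mono nhdsWithin_le_nhds] with z hz h₂ h₀ hz2 h₁
  have e₁ := L.zetaDiff_mul hp h₀ h₁ h₂
  have e₂ := L.zetaDiff_mul hz2 hp₀ (by rwa [add_comm]) (by rwa [← neg_sub, neg_mem_iff])
  rw [zetaDiff] at e₁ e₂
  rw [← neg_sub z p, zeta_neg, add_comm p z] at e₂
  have hzp : z - p ≠ 0 := sub_ne_zero.mpr hz
  rw [slope_def_field, slope_def_field]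
  field_simp
  linear_combination e₂ - e₁

lemma weierstrassP_two_mul {p : ℂ} (hp : 2 * p ∉ L.lattice) :
    L.weierstrassP (2 * p) = -2 * L.weierstrassP p +
      deriv L.derivWeierstrassP p ^ 2 / (4 * L.derivWeierstrassP p ^ 2) := by
  have hp₀ := L.notMem_of_two_mul_notMem hp
  have hb := L.derivWeierstrassP_ne_zero hp
  have hP := L.hasDerivAt_weierstrassP hp₀
  have dP := L.hasDerivAt_derivWeierstrassP hp₀
  have e₀ := L.zeta_two_mul hp
  have d2 : HasDerivAt (fun q ↦ L.zeta (2 * q)) (-L.weierstrassP (2 * p) * 2) p :=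
    (L.hasDerivAt_zeta hp).comp p (by simpa using (hasDerivAt_id p).const_mul 2)
  have d₁ := ((d2.fun_sub ((L.hasDerivAt_zeta hp₀).const_mul 2)).const_mul 2).fun_mul dP
  have d₂ := ((hP.fun_pow 2).const_mul 6).sub_const (L.g₂ / 2)
  have e := d₁.unique (d₂.congr_of_eventuallyEq <| by
    filter_upwards [L.eventually_two_mul_notMem_lattice hp] with q hq
    rw [L.zeta_two_mul hq]
    exact (L.hasDerivAt_derivWeierstrassP (L.notMem_of_two_mul_notMem hq)).deriv)
  rw [← dP.deriv] at e
  norm_num at e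
  field_simp
  linear_combination (-L.derivWeierstrassP p) * e + deriv L.derivWeierstrassP p * e₀

end PeriodPair

/-- The period pair `(1, τ)`. -/
def tauPeriodPair (τ : ℂ) (hτ : 0 < τ.im) : PeriodPair where
  ω₁ := 1
  ω₂ := τ
  indep := by
    refine LinearIndependent.pair_iff.mpr fun s t h ↦ ?_
    have ht : t = 0 := by simpa [hτ.ne'] using congr_arg Complex.im h
    subst ht
    simpa using h

lemma mem_tauPeriodPair_lattice {τ : ℂ} (hτ : 0 < τ.im) {z : ℂ} :
    z ∈ (tauPeriodPair τ hτ).lattice ↔ z ∈ Lam τ := by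
  simp only [PeriodPair.mem_lattice, tauPeriodPair, mul_one, Lam, Set.mem_ofPred_eq, eq_comm]

lemma tsum_lam'_eq {τ : ℂ} (hτ : 0 < τ.im) (f : ℂ → ℂ) :
    ∑' ω : Lam' τ, f ω =
      ∑' l : (tauPeriodPair τ hτ).lattice, if (l : ℂ) = 0 then 0 else f l := by
  have h₁ := tsum_subtype (Lam' τ) f
  have h₂ := tsum_subtype ((tauPeriodPair τ hτ).lattice : Set ℂ)
    (fun l ↦ if l = 0 then 0 else f l)
  refine h₁.trans (Eq.trans ?_ h₂.symm)
  congr with x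
  by_cases hx : x = 0 <;> by_cases hl : x ∈ Lam τ <;>
    simp [Lam', hx, hl, mem_tauPeriodPair_lattice]

lemma wp_eq_weierstrassP {τ : ℂ} (hτ : 0 < τ.im) : wp τ = (tauPeriodPair τ hτ).weierstrassP := by
  ext z
  rw [wp, tsum_lam'_eq hτ (fun ω ↦ 1 / (z - ω) ^ 2 - 1 / ω ^ 2),
    ← (tauPeriodPair τ hτ).weierstrassPExcept_add 0 z, PeriodPair.weierstrassPExcept]
  simp [add_comm]

lemma wzeta_eq_zeta {τ : ℂ} (hτ : 0 < τ.im) : wzeta τ = (tauPeriodPair τ hτ).zeta := by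
  ext z
  rw [wzeta, tsum_lam'_eq hτ (fun ω ↦ 1 / (z - ω) + 1 / ω + z / ω ^ 2)]
  rfl

lemma wpd_eq_derivWeierstrassP {τ : ℂ} (hτ : 0 < τ.im) :
    wpd τ = (tauPeriodPair τ hτ).derivWeierstrassP := by
  rw [wpd, wp_eq_weierstrassP hτ, PeriodPair.deriv_weierstrassP]

lemma wpdd_eq_deriv {τ : ℂ} (hτ : 0 < τ.im) :
    wpdd τ = deriv (tauPeriodPair τ hτ).derivWeierstrassP := by
  rw [wpdd, wp_eq_weierstrassP hτ, PeriodPair.deriv_weierstrassP]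

lemma hasDerivAt_sub_div_add {f : ℂ → ℂ} {f' z : ℂ} (hf : HasDerivAt f f' z) (h0 : f z ≠ 0)
    (K M : ℂ) :
    HasDerivAt (fun w ↦ f w - K / f w + M) (f' * (1 + K / f z ^ 2)) z :=
  ((hf.fun_sub ((hasDerivAt_const z K).fun_div hf h0)).add_const M).congr_deriv (by ring)

/-- The spectral identity as an identity of rational functions: `u = ℘(z) - ℘(p)`, `y = ℘'(z)`,
`y' = ℘''(z)`, `a = ℘(p)`, `b = ℘'(p)`, `c = ℘''(p)`. -/
lemma spectral_identity_rational {u y y' a b c A : ℂ} (hu : u ≠ 0) (hb : b ≠ 0)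
    (hy : y ^ 2 = 4 * u ^ 3 + 12 * a * u ^ 2 + 2 * c * u + b ^ 2)
    (hy' : y' = 6 * u ^ 2 + 12 * a * u + c) :
    1 / 2 * (u - (A / 2 - 3 * c / (8 * b)) * b / u +
          (-A ^ 2 + c / (2 * b) * A + 3 / 16 * (c ^ 2 / b ^ 2))) *
        (y' * (1 + (A / 2 - 3 * c / (8 * b)) * b / u ^ 2) -
          2 * ((A / 2 - 3 * c / (8 * b)) * b) * y ^ 2 / u ^ 3)
      - 1 / 4 * (y * (1 + (A / 2 - 3 * c / (8 * b)) * b / u ^ 2)) ^ 2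
      - (2 * u + 3 * a + 3 / 4 * (c / u + b ^ 2 / u ^ 2) - A * b / u + A ^ 2 - A * c / (2 * b)
          - 3 * c ^ 2 / (16 * b ^ 2)) *
        (u - (A / 2 - 3 * c / (8 * b)) * b / u +
          (-A ^ 2 + c / (2 * b) * A + 3 / 16 * (c ^ 2 / b ^ 2))) ^ 2
      = -((A ^ 3 - 5 * c / (4 * b) * A ^ 2 + 3 * (a + c ^ 2 / (16 * b ^ 2)) * A + b / 2
            - 9 * c / (4 * b) * a + 9 / 64 * (c ^ 3 / b ^ 3)) *
          (A ^ 3 - c / (4 * b) * A ^ 2 - 5 / 16 * (c ^ 2 / b ^ 2) * A + 2 * b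
            - 3 / 64 * (c ^ 3 / b ^ 3))) := by
  obtain ⟨k, rfl⟩ : ∃ k, c = k * b := ⟨c / b, by field_simp⟩
  have e₁ : 3 * (k * b) / (8 * b) = 3 * k / 8 := by field_simp
  have e₂ : (k * b) / (2 * b) = k / 2 := by field_simp
  have e₃ : (k * b) ^ 2 / b ^ 2 = k ^ 2 := by field_simp
  have e₄ : A * (k * b) / (2 * b) = A * k / 2 := by field_simp
  have e₅ : 3 * (k * b) ^ 2 / (16 * b ^ 2) = 3 * k ^ 2 / 16 := by field_simp
  have e₆ : 5 * (k * b) / (4 * b) = 5 * k / 4 := by field_simp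
  have e₇ : (k * b) ^ 2 / (16 * b ^ 2) = k ^ 2 / 16 := by field_simp
  have e₈ : 9 * (k * b) / (4 * b) = 9 * k / 4 := by field_simp
  have e₉ : (k * b) ^ 3 / b ^ 3 = k ^ 3 := by field_simp
  have e₀ : (k * b) / (4 * b) = k / 4 := by field_simp
  rw [mul_pow y, e₁, e₂, e₃, e₄, e₅, e₆, e₇, e₈, e₉, e₀, hy, hy']
  field_simp
  ring

/-- the spectral identity
`(1/2)Φ_e Φ_e'' − (1/4)(Φ_e')² − q Φ_e² = −Y₁(A)Y₂(A)` on `ℂ ∖ S`. -/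
theorem stmt_2 (τ p : ℂ) (hτ : 0 < τ.im) (hp : 2 * p ∉ Lam τ)
    (A : ℂ) (z : ℂ) (hz : z ∉ Sset τ p) :
    1 / 2 * Phie τ p A z * deriv (deriv (Phie τ p A)) z
      - 1 / 4 * (deriv (Phie τ p A) z) ^ 2
      - qpot τ p A z * (Phie τ p A z) ^ 2
      = -(Y1 τ p A * Y2 τ p A) := by
  set L := tauPeriodPair τ hτ
  simp only [← mem_tauPeriodPair_lattice hτ, Sset, Set.mem_union, Set.mem_ofPred_eq, not_or]
    at hp hz
  obtain ⟨⟨h₀, h₂⟩, h₁⟩ := hz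
  have hp₀ := L.notMem_of_two_mul_notMem hp
  have hb := L.derivWeierstrassP_ne_zero hp
  have hu := L.weierstrassP_sub_ne_zero hp h₀ h₁ h₂
  have hev : ∀ᶠ w in 𝓝 z, w ∉ L.lattice ∧ w + p ∉ L.lattice ∧ w - p ∉ L.lattice :=
    (L.eventually_notMem_lattice h₀).and
      ((L.eventually_add_notMem_lattice h₁).and (L.eventually_sub_notMem_lattice h₂))
  set a := L.weierstrassP p with ha
  set b := L.derivWeierstrassP p with hb_def
  set c := deriv L.derivWeierstrassP p with hc
  set K := (A / 2 - 3 * c / (8 * b)) * b with hK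
  set M := -A ^ 2 + c / (2 * b) * A + 3 / 16 * (c ^ 2 / b ^ 2) with hM
  have hPhi : ∀ w, w ∉ L.lattice → w + p ∉ L.lattice → w - p ∉ L.lattice →
      Phie τ p A w = (L.weierstrassP w - a) - K / (L.weierstrassP w - a) + M := by
    intro w w₀ w₁ w₂
    have e := L.zetaDiff_eq hp w₀ w₁ w₂
    rw [PeriodPair.zetaDiff, sub_eq_iff_eq_add] at e
    rw [Phie, wp_eq_weierstrassP hτ, wzeta_eq_zeta hτ, wpd_eq_derivWeierstrassP hτ,
      wpdd_eq_deriv hτ, e, hK, hM]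
    ring
  have hD : ∀ w, w ∉ L.lattice → HasDerivAt (fun w ↦ L.weierstrassP w - a)
      (L.derivWeierstrassP w) w := fun w hw ↦ (L.hasDerivAt_weierstrassP hw).sub_const a
  have hPhi1 : ∀ w, w ∉ L.lattice → w + p ∉ L.lattice → w - p ∉ L.lattice →
      deriv (Phie τ p A) w =
        L.derivWeierstrassP w * (1 + K / (L.weierstrassP w - a) ^ 2) := by
    intro w w₀ w₁ w₂
    refine ((hasDerivAt_sub_div_add (hD w w₀) (L.weierstrassP_sub_ne_zero hp w₀ w₁ w₂)
      K M).congr_of_eventuallyEq ?_).deriv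
    filter_upwards [L.eventually_notMem_lattice w₀, L.eventually_add_notMem_lattice w₁,
      L.eventually_sub_notMem_lattice w₂] with x x₀ x₁ x₂ using hPhi x x₀ x₁ x₂
  have hc' := (L.hasDerivAt_derivWeierstrassP hp₀).deriv
  have hPhi2 : deriv (deriv (Phie τ p A)) z =
      (6 * L.weierstrassP z ^ 2 - L.g₂ / 2) * (1 + K / (L.weierstrassP z - a) ^ 2) -
        2 * K * L.derivWeierstrassP z ^ 2 / (L.weierstrassP z - a) ^ 3 := by
    have d := (L.hasDerivAt_derivWeierstrassP h₀).fun_mul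
      (((hasDerivAt_const z K).fun_div ((hD z h₀).fun_pow 2) (pow_ne_zero 2 hu)).const_add 1)
    refine (d.congr_of_eventuallyEq ?_).deriv.trans ?_
    · filter_upwards [hev] with x hx using hPhi1 x hx.1 hx.2.1 hx.2.2
    · norm_num
      field_simp
      ring
  have hq : qpot τ p A z = 2 * (L.weierstrassP z - a) + 3 * a +
      3 / 4 * (c / (L.weierstrassP z - a) + b ^ 2 / (L.weierstrassP z - a) ^ 2)
      - A * b / (L.weierstrassP z - a) + A ^ 2 - A * c / (2 * b) - 3 * c ^ 2 / (16 * b ^ 2) := by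
    have e := L.zetaDiff_eq hp h₀ h₁ h₂
    rw [PeriodPair.zetaDiff, sub_eq_iff_eq_add] at e
    have e2 : L.zeta (2 * p) = 2 * L.zeta p + c / (2 * b) := by
      have := L.zeta_two_mul hp
      field_simp
      linear_combination this
    rw [qpot, Bc, wp_eq_weierstrassP hτ, wzeta_eq_zeta hτ, e, e2,
      L.weierstrassP_add_add_weierstrassP_sub hp h₀ h₁ h₂, L.weierstrassP_two_mul hp]
    ring
  have hy : L.derivWeierstrassP z ^ 2 = 4 * (L.weierstrassP z - a) ^ 3 +
      12 * a * (L.weierstrassP z - a) ^ 2 + 2 * c * (L.weierstrassP z - a) + b ^ 2 := by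
    rw [L.derivWeierstrassP_sq z h₀, hb_def, L.derivWeierstrassP_sq p hp₀, hc, hc']
    ring
  have hy' : 6 * L.weierstrassP z ^ 2 - L.g₂ / 2 =
      6 * (L.weierstrassP z - a) ^ 2 + 12 * a * (L.weierstrassP z - a) + c := by
    rw [hc, hc']
    ring
  rw [hPhi2, hPhi1 z h₀ h₁ h₂, hq, hPhi z h₀ h₁ h₂, Y1, Y2, wp_eq_weierstrassP hτ,
    wpd_eq_derivWeierstrassP hτ, wpdd_eq_deriv hτ]
  exact spectral_identity_rational hu hb hy hy'
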